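/- arXiv:2402.06122 — 3 statements merged into one kernel-verified Lean document; each statement's English description precedes it below -/
import Mathlib

section
/- (Lemma 2: the asymptotic growth rate is monotone nonincreasing in c.) Let P be a probability measure on [0,1] with mean μ = ∫ x dP(x), and let m ∈ [0,1]. Then for all real constants c, c' with 1/4 < c' < c, one has ∫ log(1 + (μ − m)(x − m)/c') dP(x) ≥ ∫ log(1 + (μ − m)(x − m)/c) dP(x). -/
open MeasureTheory

lemma neg_quarter_le_sub_mul_sub {u m x : ℝ} (hu : u ∈ Set.Icc (0 : ℝ) 1)
    (hm : m ∈ Set.Icc (0 : ℝ) 1) (hx : x ∈ Set.Icc (0 : ℝ) 1) :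
    -(1 / 4) ≤ (u - m) * (x - m) := by
  obtain ⟨hu0, hu1⟩ := hu
  obtain ⟨hm0, hm1⟩ := hm
  obtain ⟨hx0, hx1⟩ := hx
  rcases le_total m u with h | h
  · nlinarith [mul_nonneg (sub_nonneg.2 h) hx0, mul_nonneg hm0 (sub_nonneg.2 hu1),
      sq_nonneg (2 * m - 1)]
  · nlinarith [mul_nonneg (sub_nonneg.2 h) (sub_nonneg.2 hx1),
      mul_nonneg hu0 (sub_nonneg.2 hm1), sq_nonneg (2 * m - 1)]

lemma sub_mul_sub_le_one {u m x : ℝ} (hu : u ∈ Set.Icc (0 : ℝ) 1)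
    (hm : m ∈ Set.Icc (0 : ℝ) 1) (hx : x ∈ Set.Icc (0 : ℝ) 1) :
    (u - m) * (x - m) ≤ 1 := by
  have hum : |u - m| ≤ 1 := abs_le.2 ⟨by linarith [hu.1, hm.2], by linarith [hu.2, hm.1]⟩
  have hxm : |x - m| ≤ 1 := abs_le.2 ⟨by linarith [hx.1, hm.2], by linarith [hx.2, hm.1]⟩
  calc (u - m) * (x - m) ≤ |(u - m) * (x - m)| := le_abs_self _
    _ = |u - m| * |x - m| := abs_mul _ _
    _ ≤ 1 := mul_le_one₀ hum (abs_nonneg _) hxm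

lemma integrable_log_one_add_div {P : Measure ℝ} [IsProbabilityMeasure P]
    (hsupp : ∀ᵐ x ∂P, x ∈ Set.Icc (0 : ℝ) 1) {u m c : ℝ} (hu : u ∈ Set.Icc (0 : ℝ) 1)
    (hm : m ∈ Set.Icc (0 : ℝ) 1) (hc : 1 / 4 < c) :
    Integrable (fun x => Real.log (1 + (u - m) * (x - m) / c)) P := by
  have hc0 : 0 < c := by linarith
  have hδ : 0 < 1 - 1 / 4 / c := by rw [sub_pos, div_lt_one hc0]; exact hc
  refine Integrable.of_bound (C := (1 - 1 / 4 / c)⁻¹ + 1 / c)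
    (Measurable.aestronglyMeasurable (by fun_prop)) ?_
  filter_upwards [hsupp] with x hx
  have hlow : 1 - 1 / 4 / c ≤ 1 + (u - m) * (x - m) / c := by
    have := div_le_div_of_nonneg_right (neg_quarter_le_sub_mul_sub hu hm hx) hc0.le
    rw [neg_div] at this
    linarith
  have hhigh := div_le_div_of_nonneg_right (sub_mul_sub_le_one hu hm hx) hc0.le
  have hpos := hδ.trans_le hlow
  have hinv := inv_anti₀ hδ hlow
  have hδinv := inv_pos.2 hδ
  have hcinv : 0 < 1 / c := by positivity
  rw [Real.norm_eq_abs, abs_le]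
  constructor
  · linarith [Real.one_sub_inv_le_log_of_pos hpos]
  · linarith [Real.log_le_sub_one_of_pos hpos]

/-- The secant bound for the convex function `t ↦ t⁻¹`. -/
lemma inv_lineMap_le {a b x : ℝ} (ha : 0 < a) (hb : 0 < b) (hx : x ∈ Set.Icc (0 : ℝ) 1) :
    ((1 - x) * a + x * b)⁻¹ ≤ (1 - x) * a⁻¹ + x * b⁻¹ := by
  obtain ⟨hx0, hx1⟩ := hx
  have := (convexOn_zpow (𝕜 := ℝ) (-1)).2 (Set.mem_Ioi.2 ha) (Set.mem_Ioi.2 hb)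
    (sub_nonneg.2 hx1) hx0 (by ring)
  simpa only [zpow_neg_one, smul_eq_mul] using this

lemma log_one_add_div_sub_log_ge {y c c' : ℝ} (hc' : 0 < c') (hcc : c' < c)
    (hy : 0 < c' + y) :
    (1 - c' / c) * (1 - c' * (c' + y)⁻¹) ≤
      Real.log (1 + y / c') - Real.log (1 + y / c) := by
  have hc : 0 < c := hc'.trans hcc
  have hcy : 0 < c + y := by linarith
  have e' : 1 + y / c' = (c' + y) / c' := by field_simp
  have e : 1 + y / c = (c + y) / c := by field_simp
  have hp' : 0 < 1 + y / c' := e' ▸ div_pos hy hc'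
  have hp : 0 < 1 + y / c := e ▸ div_pos hcy hc
  rw [← Real.log_div hp'.ne' hp.ne']
  refine le_of_eq_of_le ?_ (Real.one_sub_inv_le_log_of_pos (div_pos hp' hp))
  rw [e, e']
  field_simp
  ring

/-- **Lemma 2: the asymptotic growth rate is monotone nonincreasing
in `c`.** For a probability measure `P` on `[0,1]` with mean `μ`, `m ∈ [0,1]`, and
`1/4 < c' < c`, one has
`∫ log(1 + (μ − m)(x − m)/c') dP(x) ≥ ∫ log(1 + (μ − m)(x − m)/c) dP(x)`. -/
theorem growth_rate_antitone_in_c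
    (P : Measure ℝ) [IsProbabilityMeasure P]
    (hsupp : ∀ᵐ x ∂P, x ∈ Set.Icc (0 : ℝ) 1)
    (μ m : ℝ) (hμ : μ = ∫ x, x ∂P) (hm : m ∈ Set.Icc (0 : ℝ) 1)
    (c c' : ℝ) (hc' : 1 / 4 < c') (hcc : c' < c) :
    ∫ x, Real.log (1 + (μ - m) * (x - m) / c) ∂P
      ≤ ∫ x, Real.log (1 + (μ - m) * (x - m) / c') ∂P := by
  have hid : Integrable (fun x : ℝ => x) P := by
    refine Integrable.of_bound (C := 1) measurable_id.aestronglyMeasurable ?_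
    filter_upwards [hsupp] with x hx
    rw [Real.norm_eq_abs, abs_of_nonneg hx.1]
    exact hx.2
  have hμI : μ ∈ Set.Icc (0 : ℝ) 1 :=
    hμ ▸ (convex_Icc (0 : ℝ) 1).integral_mem isClosed_Icc hsupp hid
  have hc'0 : 0 < c' := by linarith
  have hc0 : 0 < c := hc'0.trans hcc
  have hint := integrable_log_one_add_div hsupp hμI hm (hc'.trans hcc)
  have hint' := integrable_log_one_add_div hsupp hμI hm hc'
  have hpos : ∀ x ∈ Set.Icc (0 : ℝ) 1, 0 < c' + (μ - m) * (x - m) := fun x hx => by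
    linarith [neg_quarter_le_sub_mul_sub hμI hm hx]
  have hD₀ := hpos 0 (by simp)
  have hD₁ := hpos 1 (by simp)
  set D₀ := c' + (μ - m) * (0 - m) with hD₀_def
  set D₁ := c' + (μ - m) * (1 - m) with hD₁_def
  have hk : 0 ≤ 1 - c' / c := sub_nonneg.2 ((div_le_one hc0).2 hcc.le)
  have hlower : ∀ᵐ x ∂P,
      (1 - c' / c) * (1 - c' * D₀⁻¹ + c' * (D₀⁻¹ - D₁⁻¹) * x) ≤
        Real.log (1 + (μ - m) * (x - m) / c') - Real.log (1 + (μ - m) * (x - m) / c) := by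
    filter_upwards [hsupp] with x hx
    refine le_trans (mul_le_mul_of_nonneg_left ?_ hk)
      (log_one_add_div_sub_log_ge hc'0 hcc (hpos x hx))
    have hsec := inv_lineMap_le hD₀ hD₁ hx
    have hD : (1 - x) * D₀ + x * D₁ = c' + (μ - m) * (x - m) := by
      rw [hD₀_def, hD₁_def]; ring
    rw [hD] at hsec
    linarith [mul_le_mul_of_nonneg_left hsec hc'0.le]
  have hmean : 0 ≤ 1 - c' * D₀⁻¹ + c' * (D₀⁻¹ - D₁⁻¹) * μ := by
    have heq : 1 - c' * D₀⁻¹ + c' * (D₀⁻¹ - D₁⁻¹) * μ =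
        (μ - m) ^ 2 * (c' - m * (1 - m)) / (D₀ * D₁) := by
      have hnum : (μ - m) ^ 2 * (c' - m * (1 - m)) =
          D₀ * D₁ - c' * ((1 - μ) * D₁ + μ * D₀) := by
        rw [hD₀_def, hD₁_def]; ring
      rw [hnum]
      field_simp
      ring
    rw [heq]
    have : 0 ≤ c' - m * (1 - m) := by nlinarith [sq_nonneg (2 * m - 1)]
    positivity
  have hlin : Integrable (fun x : ℝ => c' * (D₀⁻¹ - D₁⁻¹) * x) P := hid.const_mul _
  have hle := integral_mono_ae
    (((integrable_const (1 - c' * D₀⁻¹)).add hlin).const_mul (1 - c' / c))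
    (hint'.sub hint) hlower
  simp only [Pi.add_apply, Pi.sub_apply] at hle
  rw [integral_const_mul, integral_add (integrable_const _) hlin, integral_const_mul, ← hμ,
    integral_sub hint' hint, integral_const, probReal_univ, one_smul] at hle
  linarith [mul_nonneg hk hmean]
end

section
/- (Lemma 3, worst-case nonnegativity.) Let c > 1/4 and μ, m ∈ [0,1], and define g(c, m, μ) = μ·log(1 + (μ − m)(1 − m)/c) + (1 − μ)·log(1 − (μ − m)·m/c). Then g(c, m, μ) ≥ 0, and g(c, m, μ) = 0 if and only if m = μ. -/
/-- Lower bound for the expected logarithm of the wealth factor of a Bernoulli bet, obtained from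
`1 - x⁻¹ ≤ log x`. -/
theorem bernoulli_log_growth_lower_bound {c μ m : ℝ} (hc : 0 < c) (hμ : μ ∈ Set.Icc (0 : ℝ) 1)
    (hA : 0 < c + (μ - m) * (1 - m)) (hB : 0 < c - (μ - m) * m) :
    (μ - m) ^ 2 * (c - m * (1 - m)) / ((c + (μ - m) * (1 - m)) * (c - (μ - m) * m)) ≤
      μ * Real.log (1 + (μ - m) * (1 - m) / c)
        + (1 - μ) * Real.log (1 - (μ - m) * m / c) := by
  obtain ⟨hμ0, hμ1⟩ := hμ
  have hA_eq : 1 + (μ - m) * (1 - m) / c = (c + (μ - m) * (1 - m)) / c := by field_simp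
  have hB_eq : 1 - (μ - m) * m / c = (c - (μ - m) * m) / c := by field_simp
  rw [hA_eq, hB_eq]
  have h₁ := mul_le_mul_of_nonneg_left (Real.one_sub_inv_le_log_of_pos (div_pos hA hc)) hμ0
  have h₂ := mul_le_mul_of_nonneg_left (Real.one_sub_inv_le_log_of_pos (div_pos hB hc))
    (sub_nonneg.2 hμ1)
  refine le_trans (le_of_eq ?_) (add_le_add h₁ h₂)
  have hA_ne := hA.ne'
  have hB_ne := hB.ne'
  rw [inv_div, inv_div, one_sub_div hA_ne, one_sub_div hB_ne, mul_div_assoc', mul_div_assoc',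
    div_add_div _ _ hA_ne hB_ne]
  ring

/-- **Lemma 3, worst-case nonnegativity.** For `c > 1/4` and
`μ, m ∈ [0,1]`, the Bernoulli growth rate
`g(c, m, μ) = μ·log(1 + (μ − m)(1 − m)/c) + (1 − μ)·log(1 − (μ − m)·m/c)`
satisfies `g ≥ 0`, with equality if and only if `m = μ`. -/
theorem bernoulli_growth_rate_nonneg
    (c μ m : ℝ) (hc : 1 / 4 < c)
    (hμ : μ ∈ Set.Icc (0 : ℝ) 1) (hm : m ∈ Set.Icc (0 : ℝ) 1) :
    0 ≤ μ * Real.log (1 + (μ - m) * (1 - m) / c)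
          + (1 - μ) * Real.log (1 - (μ - m) * m / c) ∧
      (μ * Real.log (1 + (μ - m) * (1 - m) / c)
          + (1 - μ) * Real.log (1 - (μ - m) * m / c) = 0 ↔ m = μ) := by
  have hc0 : 0 < c := by linarith
  have hvar : 0 < c - m * (1 - m) := by nlinarith [sq_nonneg (m - 1 / 2)]
  have hA : 0 < c + (μ - m) * (1 - m) := by
    nlinarith [mul_nonneg hμ.1 (sub_nonneg.2 hm.2)]
  have hB : 0 < c - (μ - m) * m := by
    nlinarith [mul_nonneg (sub_nonneg.2 hμ.2) hm.1]
  have hbound := bernoulli_log_growth_lower_bound hc0 hμ hA hB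
  refine ⟨le_trans (by positivity) hbound, fun h => ?_, fun h => by simp [h]⟩
  by_contra hne
  have hd : μ - m ≠ 0 := sub_ne_zero.2 (Ne.symm hne)
  have hpos : 0 < (μ - m) ^ 2 * (c - m * (1 - m)) /
      ((c + (μ - m) * (1 - m)) * (c - (μ - m) * m)) := by positivity
  linarith
end

section
/- (Lemma 3, monotonicity in the distance |μ − m|.) Let c > 1/4 and μ ∈ [0,1], and define g(c, m, μ) = μ·log(1 + (μ − m)(1 − m)/c) + (1 − μ)·log(1 − (μ − m)·m/c). Then the map m ↦ g(c, m, μ) is strictly decreasing on the interval [0, μ] and strictly increasing on the interval [μ, 1]; in particular g(c, m, μ) is monotonically increasing as a function of |μ − m| on each side of μ. -/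
/-- The arguments of both logarithms in the Bernoulli growth rate are positive. -/
lemma growth_args_pos {c μ m : ℝ} (hc : 1 / 4 < c) (hμ : μ ∈ Set.Icc (0 : ℝ) 1)
    (hm : m ∈ Set.Icc (0 : ℝ) 1) :
    0 < 1 + (μ - m) * (1 - m) / c ∧ 0 < 1 - (μ - m) * m / c := by
  obtain ⟨hμ0, hμ1⟩ := hμ
  obtain ⟨hm0, hm1⟩ := hm
  have hc0 : 0 < c := by linarith
  have hA : 0 < c + (μ - m) * (1 - m) := by
    nlinarith [sq_nonneg (2 * m - 1), mul_nonneg hμ0 (sub_nonneg.2 hm1)]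
  have hB : 0 < c - (μ - m) * m := by
    nlinarith [sq_nonneg (2 * m - 1), mul_nonneg (sub_nonneg.2 hμ1) hm0]
  constructor
  · have h := div_pos hA hc0
    rwa [add_div, div_self hc0.ne'] at h
  · have h := div_pos hB hc0
    rwa [sub_div, div_self hc0.ne'] at h

/-- The derivative of the Bernoulli growth rate in `m` is `m - μ` times a positive factor. -/
lemma exists_pos_hasDerivAt_growth {c μ m : ℝ} (hc : 1 / 4 < c) (hμ : μ ∈ Set.Icc (0 : ℝ) 1)
    (hm : m ∈ Set.Icc (0 : ℝ) 1) :
    ∃ k : ℝ, 0 < k ∧ HasDerivAt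
      (fun m : ℝ => μ * Real.log (1 + (μ - m) * (1 - m) / c)
        + (1 - μ) * Real.log (1 - (μ - m) * m / c)) ((m - μ) * k) m := by
  obtain ⟨hA, hB⟩ := growth_args_pos hc hμ hm
  have hc0 : 0 < c := by linarith
  have hid := hasDerivAt_id' m
  have hdA := ((((hid.const_sub μ).mul (hid.const_sub 1)).div_const c).const_add 1).log hA.ne'
  have hdB := ((((hid.const_sub μ).mul hid).div_const c).const_sub 1).log hB.ne'
  refine ⟨(2 * c - 2 * m * (1 - m) + μ * (1 - μ)) /
    (c ^ 2 * ((1 + (μ - m) * (1 - m) / c) * (1 - (μ - m) * m / c))), ?_, ?_⟩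
  · refine div_pos ?_ (by positivity)
    nlinarith [sq_nonneg (2 * m - 1), mul_nonneg hμ.1 (sub_nonneg.2 hμ.2)]
  · refine ((hdA.const_mul μ).add (hdB.const_mul (1 - μ))).congr_deriv ?_
    simp only [Pi.mul_apply]
    rw [← mul_div_assoc μ, ← mul_div_assoc (1 - μ), div_add_div _ _ hA.ne' hB.ne',
      ← mul_div_assoc (m - μ),
      div_eq_div_iff (mul_pos hA hB).ne' (by positivity)]
    field_simp
    ring

/-- **Lemma 3, monotonicity in the distance `|μ − m|`.** For
`c > 1/4` and `μ ∈ [0,1]`, the map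
`m ↦ g(c, m, μ) = μ·log(1 + (μ − m)(1 − m)/c) + (1 − μ)·log(1 − (μ − m)·m/c)`
is strictly decreasing on `[0, μ]` and strictly increasing on `[μ, 1]`. -/
theorem bernoulli_growth_rate_monotone_in_distance
    (c μ : ℝ) (hc : 1 / 4 < c) (hμ : μ ∈ Set.Icc (0 : ℝ) 1) :
    StrictAntiOn
        (fun m : ℝ => μ * Real.log (1 + (μ - m) * (1 - m) / c)
          + (1 - μ) * Real.log (1 - (μ - m) * m / c)) (Set.Icc 0 μ) ∧
      StrictMonoOn
        (fun m : ℝ => μ * Real.log (1 + (μ - m) * (1 - m) / c)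
          + (1 - μ) * Real.log (1 - (μ - m) * m / c)) (Set.Icc μ 1) := by
  have key := fun {m : ℝ} => exists_pos_hasDerivAt_growth (m := m) hc hμ
  constructor
  · refine strictAntiOn_of_deriv_neg (convex_Icc 0 μ) (fun m hm => ?_) (fun m hm => ?_)
    · obtain ⟨k, -, hk⟩ := key ⟨hm.1, hm.2.trans hμ.2⟩
      exact hk.continuousAt.continuousWithinAt
    · rw [interior_Icc] at hm
      obtain ⟨k, hk0, hk⟩ := key ⟨hm.1.le, hm.2.le.trans hμ.2⟩
      rw [hk.deriv]
      exact mul_neg_of_neg_of_pos (sub_neg.2 hm.2) hk0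
  · refine strictMonoOn_of_deriv_pos (convex_Icc μ 1) (fun m hm => ?_) (fun m hm => ?_)
    · obtain ⟨k, -, hk⟩ := key ⟨hμ.1.trans hm.1, hm.2⟩
      exact hk.continuousAt.continuousWithinAt
    · rw [interior_Icc] at hm
      obtain ⟨k, hk0, hk⟩ := key ⟨hμ.1.trans hm.1.le, hm.2.le⟩
      rw [hk.deriv]
      exact mul_pos (sub_pos.2 hm.1) hk0
end
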